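/- If γ: [a,b] → ℝⁿ is absolutely continuous and ε > 0, then there exists a C¹ curve Γ: [a,b] → ℝⁿ such that the Lebesgue measure of {t ∈ [a,b] : Γ(t) ≠ γ(t) or Γ'(t) ≠ γ'(t)} is less than ε. -/

import Mathlib

open MeasureTheory Set

theorem gap_est {M δ ε N D r : ℝ} (hδ : 0 < δ) (hD : 0 < D) (hε : 0 < ε)
    (hN : N ≤ 2 * M) (hND : D < δ → N ≤ ε * D) (hr : 0 ≤ r) (hrD : r ≤ D)
    (hrρ : r * (2 * M) ≤ ε * δ ^ 2) : N * r ≤ ε * D ^ 2 := by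
  by_cases h : D < δ
  · have := hND h
    calc N * r ≤ (ε * D) * D := by gcongr
      _ = _ := by ring
  · push Not at h
    calc N * r ≤ (2 * M) * r := by gcongr
      _ ≤ ε * δ ^ 2 := by linarith
      _ ≤ _ := by gcongr

theorem whitney_core {E : Type*} [NormedAddCommGroup E] [NormedSpace ℝ E] (K : Set ℝ)
    (hK : IsClosed K) (hlo : ∀ t, ∃ k ∈ K, k ≤ t) (hhi : ∀ t, ∃ k ∈ K, t ≤ k)
    (φ : ℝ → E) (M : ℝ) (hM : ∀ x ∈ K, ‖φ x‖ ≤ M)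
    (hu : ∀ ε > 0, ∃ δ > 0, ∀ x ∈ K, ∀ y ∈ K, |y - x| < δ → ‖φ y - φ x‖ ≤ ε * |y - x|) :
    ∃ Γ : ℝ → E, ContDiff ℝ 1 Γ ∧ ∀ x ∈ K, Γ x = φ x ∧ HasDerivAt Γ 0 x := by
  have hc : ∀ t, ∃ c ∈ K, c ≤ t ∧ ∀ k ∈ K, k ≤ t → k ≤ c := by
    intro t
    have hne : (K ∩ Iic t).Nonempty := by
      obtain ⟨k, hk, hkt⟩ := hlo t
      exact ⟨k, hk, hkt⟩
    have hb : BddAbove (K ∩ Iic t) := ⟨t, fun k hk => hk.2⟩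
    have hm := (hK.inter isClosed_Iic).csSup_mem hne hb
    exact ⟨_, hm.1, hm.2, fun k hk hkt => le_csSup hb ⟨hk, hkt⟩⟩
  have hd : ∀ t, ∃ d ∈ K, t ≤ d ∧ ∀ k ∈ K, t ≤ k → d ≤ k := by
    intro t
    have hne : (K ∩ Ici t).Nonempty := by
      obtain ⟨k, hk, hkt⟩ := hhi t
      exact ⟨k, hk, hkt⟩
    have hb : BddBelow (K ∩ Ici t) := ⟨t, fun k hk => hk.2⟩
    have hm := (hK.inter isClosed_Ici).csInf_mem hne hb
    exact ⟨_, hm.1, hm.2, fun k hk hkt => csInf_le hb ⟨hk, hkt⟩⟩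
  choose c hcK hct hcm using hc
  choose d hdK hdt hdm using hd
  have hcx : ∀ x ∈ K, c x = x := fun x hx => le_antisymm (hct x) (hcm x x hx le_rfl)
  have hdx : ∀ x ∈ K, d x = x := fun x hx => le_antisymm (hdm x x hx le_rfl) (hdt x)
  have hM0 : 0 ≤ M := (norm_nonneg _).trans (hM _ (hcK 0))
  set Γ : ℝ → E := fun t => φ (c t) +
    (3 * ((t - c t) / (d t - c t)) ^ 2 - 2 * ((t - c t) / (d t - c t)) ^ 3) • (φ (d t) - φ (c t))
    with hΓ
  set h : ℝ → E := fun t =>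
    (6 * ((t - c t) / (d t - c t)) * (1 - (t - c t) / (d t - c t)) / (d t - c t)) •
      (φ (d t) - φ (c t)) with hh
  have hΓK : ∀ x ∈ K, Γ x = φ x := by
    intro x hx; simp [hΓ, hcx x hx, hdx x hx]
  have hhK : ∀ x ∈ K, h x = 0 := by
    intro x hx; simp [hh, hcx x hx, hdx x hx]
  -- off K
  have hcl : ∀ t ∉ K, c t < t := fun t ht =>
    lt_of_le_of_ne (hct t) (fun e => ht (e ▸ hcK t))
  have hdl : ∀ t ∉ K, t < d t := fun t ht =>
    lt_of_le_of_ne (hdt t) (fun e => ht (e ▸ hdK t))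
  have hloc : ∀ t ∉ K, ∀ᶠ s in nhds t, c s = c t ∧ d s = d t := by
    intro t ht
    filter_upwards [Ioo_mem_nhds (hcl t ht) (hdl t ht)] with s hs
    have hcs : c s < d t := (hct s).trans_lt hs.2
    have hds : c t < d s := hs.1.trans_le (hdt s)
    constructor
    · refine le_antisymm (hcm t _ (hcK s) ?_) (hcm s _ (hcK t) hs.1.le)
      by_contra hcon
      push Not at hcon
      exact absurd (hdm t _ (hcK s) hcon.le) (not_le.2 hcs)
    · refine le_antisymm (hdm s _ (hdK t) hs.2.le) (hdm t _ (hdK s) ?_)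
      by_contra hcon
      push Not at hcon
      exact absurd (hcm t _ (hdK s) hcon.le) (not_le.2 hds)
  -- quantitative estimate at points of K
  have hq : ∀ x ∈ K, ∀ ε > 0, ∃ ρ > 0, ∀ t, |t - x| < ρ →
      ‖Γ t - φ x‖ ≤ 4 * ε * |t - x| ∧ ‖h t‖ ≤ 6 * ε := by
    intro x hx ε hε
    obtain ⟨δ, hδ, hδu⟩ := hu ε hε
    refine ⟨min δ (ε * δ ^ 2 / (2 * M + 1)), by positivity, fun t ht => ?_⟩
    have ht1 : |t - x| < δ := ht.trans_le (min_le_left _ _)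
    have ht2 : |t - x| * (2 * M) ≤ ε * δ ^ 2 := by
      have := (ht.trans_le (min_le_right _ _)).le
      rw [le_div_iff₀ (by positivity)] at this
      nlinarith [abs_nonneg (t - x)]
    by_cases htK : t ∈ K
    · rw [hΓK t htK, hhK t htK]
      have := hδu x hx t htK ht1
      refine ⟨this.trans ?_, by simp; positivity⟩
      nlinarith [mul_nonneg hε.le (abs_nonneg (t - x))]
    have h1 := hcl t htK
    have h2 := hdl t htK
    set D := d t - c t with hD
    have hDp : 0 < D := by linarith
    set N := ‖φ (d t) - φ (c t)‖ with hN
    have hN0 : 0 ≤ N := norm_nonneg _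
    have hN2 : N ≤ 2 * M := by
      have := norm_sub_le (φ (d t)) (φ (c t))
      have := hM _ (hcK t)
      have := hM _ (hdK t)
      linarith
    have hND : D < δ → N ≤ ε * D := by
      intro hlt
      have := hδu _ (hcK t) _ (hdK t) (by rwa [abs_of_pos hDp])
      rwa [abs_of_pos hDp] at this
    set τ := (t - c t) / D with hτ
    have hτ0 : 0 ≤ τ := by apply div_nonneg <;> linarith
    have hτ1 : τ ≤ 1 := by rw [hτ, div_le_one hDp]; linarith
    have htr : t - c t = τ * D := by rw [hτ]; field_simp
    have htr' : d t - t = (1 - τ) * D := by linarith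
    have hhn : ‖h t‖ = 6 * τ * (1 - τ) / D * N := by
      simp only [hh]
      rw [norm_smul, Real.norm_of_nonneg]
      have : 0 ≤ 1 - τ := by linarith
      positivity
    rcases lt_or_ge t x with htx | htx
    · -- d t ≤ x
      have hdx' : d t ≤ x := hdm t x hx htx.le
      have habs : |t - x| = x - t := by rw [abs_of_neg] <;> linarith
      rw [habs] at ht1 ht2 ⊢
      have hQ := gap_est (r := d t - t) hδ hDp hε hN2 hND (by linarith) (by linarith)
        (le_trans (by gcongr) ht2)
      have hQ' : N * (1 - τ) ≤ ε * D := by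
        rw [htr'] at hQ
        have : (N * (1 - τ)) * D ≤ (ε * D) * D := by linarith
        exact le_of_mul_le_mul_right this hDp
      have hA : ‖φ (d t) - φ x‖ ≤ ε * (x - d t) := by
        have := hδu x hx _ (hdK t) (by rw [abs_lt]; constructor <;> linarith)
        rwa [abs_of_nonpos (by linarith), neg_sub] at this
      constructor
      · have e : Γ t - φ x = (φ (d t) - φ x) -
            ((1 - τ) ^ 2 * (1 + 2 * τ)) • (φ (d t) - φ (c t)) := by
          simp only [hΓ]
          module
        rw [e]
        refine (norm_sub_le _ _).trans ?_
        rw [norm_smul, Real.norm_of_nonneg (by positivity)]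
        have : (1 - τ) ^ 2 * (1 + 2 * τ) * N ≤ 3 * ε * (d t - t) := by
          have h3 : (1 - τ) * (1 + 2 * τ) * (N * (1 - τ)) ≤ (1 - τ) * 3 * (ε * D) := by
            have : 0 ≤ 1 - τ := by linarith
            gcongr
            linarith
          rw [htr']; linarith
        nlinarith
      · rw [hhn, div_mul_eq_mul_div, div_le_iff₀ hDp]
        have : τ * (N * (1 - τ)) ≤ 1 * (ε * D) := by gcongr
        linarith
    · have hdx' : x ≤ c t := hcm t x hx htx
      have habs : |t - x| = t - x := abs_of_nonneg (by linarith)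
      rw [habs] at ht1 ht2 ⊢
      have hQ := gap_est (r := t - c t) hδ hDp hε hN2 hND (by linarith) (by linarith)
        (le_trans (by gcongr) ht2)
      have hQ' : N * τ ≤ ε * D := by
        rw [htr] at hQ
        have : (N * τ) * D ≤ (ε * D) * D := by linarith
        exact le_of_mul_le_mul_right this hDp
      have hA : ‖φ (c t) - φ x‖ ≤ ε * (c t - x) := by
        have := hδu x hx _ (hcK t) (by rw [abs_lt]; constructor <;> linarith)
        rwa [abs_of_nonneg (by linarith)] at this
      constructor
      · have e : Γ t - φ x = (φ (c t) - φ x) +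
            (τ ^ 2 * (1 + 2 * (1 - τ))) • (φ (d t) - φ (c t)) := by
          simp only [hΓ]
          module
        have h01 : 0 ≤ 1 - τ := by linarith
        rw [e]
        refine (norm_add_le _ _).trans ?_
        rw [norm_smul, Real.norm_of_nonneg (by positivity)]
        have : τ ^ 2 * (1 + 2 * (1 - τ)) * N ≤ 3 * ε * (t - c t) := by
          have h3 : τ * (1 + 2 * (1 - τ)) * (N * τ) ≤ τ * 3 * (ε * D) := by
            gcongr
            linarith
          rw [htr]; linarith
        nlinarith
      · rw [hhn, div_mul_eq_mul_div, div_le_iff₀ hDp]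
        have : (1 - τ) * (N * τ) ≤ 1 * (ε * D) := by
          gcongr
          linarith
        linarith
  have hder : ∀ t, HasDerivAt Γ (h t) t := by
    intro t
    by_cases htK : t ∈ K
    · rw [hhK t htK, hasDerivAt_iff_isLittleO, Asymptotics.isLittleO_iff]
      intro e he
      obtain ⟨ρ, hρ, H⟩ := hq t htK (e / 4) (by positivity)
      filter_upwards [Metric.ball_mem_nhds t hρ] with s hs
      have := (H s (by simpa [Real.dist_eq] using hs)).1
      rw [hΓK t htK, Real.norm_eq_abs, smul_zero, sub_zero]
      linarith
    · have h1 := hcl t htK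
      have h2 := hdl t htK
      have hDp : d t - c t ≠ 0 := by linarith
      have hlin : HasDerivAt (fun s : ℝ => (s - c t) / (d t - c t)) (1 / (d t - c t)) t :=
        ((hasDerivAt_id t).sub_const _).div_const _
      have hp := ((((hlin.pow 2).const_mul 3).sub ((hlin.pow 3).const_mul 2)).smul_const
        (φ (d t) - φ (c t))).const_add (φ (c t))
      have := hp.congr_of_eventuallyEq (f₁ := Γ) (by
        filter_upwards [hloc t htK] with s hs
        simp [hΓ, hs.1, hs.2])
      convert this using 1
      simp only [hh]
      congr 1
      push_cast
      ring
  have hcont : Continuous h := by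
    rw [continuous_iff_continuousAt]
    intro t
    by_cases htK : t ∈ K
    · rw [Metric.continuousAt_iff]
      intro e he
      obtain ⟨ρ, hρ, H⟩ := hq t htK (e / 12) (by positivity)
      refine ⟨ρ, hρ, fun s hs => ?_⟩
      have := (H s (by simpa [Real.dist_eq] using hs)).2
      rw [hhK t htK, dist_zero_right]
      linarith
    · have : Continuous (fun s : ℝ =>
        (6 * ((s - c t) / (d t - c t)) * (1 - (s - c t) / (d t - c t)) / (d t - c t)) •
          (φ (d t) - φ (c t))) := by fun_prop
      refine this.continuousAt.congr ?_
      filter_upwards [hloc t htK] with s hs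
      simp [hh, hs.1, hs.2]
  refine ⟨Γ, ?_, fun x hx => ⟨hΓK x hx, hhK x hx ▸ hder x⟩⟩
  rw [contDiff_one_iff_deriv]
  refine ⟨fun t => (hder t).differentiableAt, ?_⟩
  rwa [funext fun t => (hder t).deriv]

/-- Whitney extension from a compact set when the prescribed derivative is zero. -/
theorem whitney_compact {E : Type*} [NormedAddCommGroup E] [NormedSpace ℝ E] (K : Set ℝ)
    (hK : IsCompact K) (φ : ℝ → E) (hφ : Continuous φ)
    (hu : ∀ ε > 0, ∃ δ > 0, ∀ x ∈ K, ∀ y ∈ K, |y - x| < δ → ‖φ y - φ x‖ ≤ ε * |y - x|) :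
    ∃ Γ : ℝ → E, ContDiff ℝ 1 Γ ∧ ∀ x ∈ K, Γ x = φ x ∧ HasDerivAt Γ 0 x := by
  rcases K.eq_empty_or_nonempty with rfl | hne
  · exact ⟨fun _ => 0, contDiff_const, by simp⟩
  obtain ⟨p, hp, hpm⟩ := hK.exists_isLeast hne
  obtain ⟨q, hq, hqm⟩ := hK.exists_isGreatest hne
  have hpq : p ≤ q := hpm hq
  set cl : ℝ → ℝ := fun t => max p (min q t) with hcl
  have hclc : Continuous cl := by fun_prop
  have hclK : ∀ x ∈ K, cl x = x := fun x hx => by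
    simp [hcl, min_eq_right (hqm hx), max_eq_right (hpm hx)]
  have hcll : ∀ x y, |cl y - cl x| ≤ |y - x| := by
    intro x y
    refine (abs_max_sub_max_le_max _ _ _ _).trans ?_
    simp only [sub_self, abs_zero]
    refine max_le (abs_nonneg _) ((abs_min_sub_min_le_max _ _ _ _).trans ?_)
    simp
  obtain ⟨M, hM⟩ := hK.exists_bound_of_continuousOn hφ.continuousOn
  obtain ⟨Γ, h1, h2⟩ := whitney_core (cl ⁻¹' K) (hK.isClosed.preimage hclc)
    (fun t => ⟨min p t, by
      have : cl (min p t) = p := by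
        simp only [hcl]
        rw [max_eq_left]
        exact (min_le_right _ _).trans (min_le_left _ _)
      rw [mem_preimage, this]; exact hp, min_le_right _ _⟩)
    (fun t => ⟨max q t, by
      have : cl (max q t) = q := by
        simp only [hcl]
        rw [min_eq_left (le_max_left _ _), max_eq_right hpq]
      rw [mem_preimage, this]; exact hq, le_max_right _ _⟩)
    (φ ∘ cl) M (fun x hx => hM _ hx) (by
      intro ε hε
      obtain ⟨δ, hδ, H⟩ := hu ε hε
      refine ⟨δ, hδ, fun x hx y hy hxy => ?_⟩
      refine (H _ hx _ hy ((hcll x y).trans_lt hxy)).trans ?_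
      have := hcll x y
      gcongr)
  refine ⟨Γ, h1, fun x hx => ?_⟩
  have := h2 x (by rw [mem_preimage, hclK x hx]; exact hx)
  rwa [Function.comp, hclK x hx] at this

/-- Egorov-type selection: uniform differentiability on a large compact subset. -/
theorem unif_diff {E : Type*} [NormedAddCommGroup E] [NormedSpace ℝ E] (γ g : ℝ → E)
    (hγ : Continuous γ) (K₁ : Set ℝ) (hK₁ : IsCompact K₁) (hd : ∀ x ∈ K₁, HasDerivAt γ (g x) x)
    (ε : ENNReal) (hε : 0 < ε) :
    ∃ K ⊆ K₁, IsCompact K ∧ volume (K₁ \ K) < ε ∧ ∀ e > 0, ∃ δ > 0, ∀ x ∈ K, ∀ u,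
      |u - x| < δ → ‖γ u - γ x - (u - x) • g x‖ ≤ e * |u - x| := by
  set A : ℕ → ℕ → Set ℝ := fun m k => {x | ∀ u v, |u - x| < 1 / ((k : ℝ) + 1) →
    |v - x| < 1 / ((k : ℝ) + 1) →
    ‖(v - x) • (γ u - γ x) - (u - x) • (γ v - γ x)‖ ≤ |u - x| * |v - x| / ((m : ℝ) + 1)} with hA
  have hAc : ∀ m k, IsClosed (A m k) := by
    intro m k
    simp only [hA, ofPred_forall]
    refine isClosed_iInter fun u => isClosed_iInter fun v => ?_
    simp only [imp_iff_not_or, not_lt, ofPred_or]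
    refine IsClosed.union (isClosed_le (by fun_prop) (by fun_prop))
      (IsClosed.union (isClosed_le (by fun_prop) (by fun_prop))
        (isClosed_le (by fun_prop) (by fun_prop)))
  have hAm : ∀ m, Monotone (A m) := by
    intro m k l hkl x hx u v hu hv
    have : 1 / ((l : ℝ) + 1) ≤ 1 / ((k : ℝ) + 1) := by gcongr
    exact hx u v (hu.trans_le this) (hv.trans_le this)
  have hAU : ∀ m, ∀ x ∈ K₁, ∃ k, x ∈ A m k := by
    intro m x hx
    have h1 := hd x hx
    rw [hasDerivAt_iff_isLittleO, Asymptotics.isLittleO_iff] at h1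
    have h2 := h1 (c := 1 / (2 * ((m : ℝ) + 1))) (by positivity)
    obtain ⟨δ, hδ, H⟩ := Metric.eventually_nhds_iff.1 h2
    obtain ⟨k, hk⟩ := exists_nat_one_div_lt hδ
    refine ⟨k, fun u v hu hv => ?_⟩
    have Hu := H (y := u) (by rw [Real.dist_eq]; exact hu.trans hk)
    have Hv := H (y := v) (by rw [Real.dist_eq]; exact hv.trans hk)
    rw [Real.norm_eq_abs] at Hu Hv
    have e : (v - x) • (γ u - γ x) - (u - x) • (γ v - γ x) =
      (v - x) • (γ u - γ x - (u - x) • g x) - (u - x) • (γ v - γ x - (v - x) • g x) := by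
      module
    rw [e]
    refine (norm_sub_le _ _).trans ?_
    rw [norm_smul, norm_smul, Real.norm_eq_abs, Real.norm_eq_abs]
    calc _ ≤ |v - x| * (1 / (2 * ((m : ℝ) + 1)) * |u - x|) +
          |u - x| * (1 / (2 * ((m : ℝ) + 1)) * |v - x|) := by gcongr
      _ = _ := by field_simp; ring
  obtain ⟨η, hη, hηs⟩ := ENNReal.exists_pos_sum_of_countable' hε.ne' ℕ
  have hk : ∀ m, ∃ k, volume (K₁ \ A m k) < η m := by
    intro m
    have ht := tendsto_measure_iInter_atTop (μ := volume) (s := fun k => K₁ \ A m k)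
      (fun k => (hK₁.measurableSet.diff (hAc m k).measurableSet).nullMeasurableSet)
      (fun k l hkl => sdiff_subset_sdiff_right (hAm m hkl))
      ⟨0, ((measure_mono sdiff_subset).trans_lt hK₁.measure_lt_top).ne⟩
    have he : ⋂ k, K₁ \ A m k = ∅ := by
      rw [eq_empty_iff_forall_notMem]
      intro x hx
      rw [mem_iInter] at hx
      obtain ⟨k, hk⟩ := hAU m x (hx 0).1
      exact (hx k).2 hk
    rw [he, measure_empty] at ht
    exact (ht.eventually_lt_const (hη m)).exists
  choose k hk using hk
  refine ⟨K₁ ∩ ⋂ m, A m (k m), inter_subset_left,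
    hK₁.inter_right (isClosed_iInter fun m => hAc _ _), ?_, ?_⟩
  · have : K₁ \ (K₁ ∩ ⋂ m, A m (k m)) ⊆ ⋃ m, K₁ \ A m (k m) := by
      rintro x ⟨hx, hx'⟩
      simp only [mem_inter_iff, mem_iInter, not_and, not_forall] at hx'
      obtain ⟨m, hm⟩ := hx' hx
      exact mem_iUnion.2 ⟨m, hx, hm⟩
    calc _ ≤ _ := measure_mono this
      _ ≤ ∑' m, volume (K₁ \ A m (k m)) := measure_iUnion_le _
      _ ≤ ∑' m, η m := ENNReal.tsum_le_tsum fun m => (hk m).le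
      _ < ε := hηs
  · intro e he
    obtain ⟨m, hm⟩ := exists_nat_one_div_lt he
    refine ⟨1 / ((k m : ℝ) + 1), by positivity, fun x hx u hu => ?_⟩
    have hxA := mem_iInter.1 hx.2 m
    have hs := hasDerivAt_iff_tendsto_slope.1 (hd x hx.1)
    have ht : Filter.Tendsto (fun v => ‖γ u - γ x - (u - x) • slope γ x v‖)
        (nhdsWithin x {x}ᶜ) (nhds ‖γ u - γ x - (u - x) • g x‖) :=
      (tendsto_const_nhds.sub (hs.const_smul _)).norm
    refine le_of_tendsto ht ?_
    have hb : ∀ᶠ v in nhdsWithin x {x}ᶜ, |v - x| < 1 / ((k m : ℝ) + 1) := by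
      refine nhdsWithin_le_nhds ?_
      filter_upwards [Metric.ball_mem_nhds x (show 0 < 1 / ((k m : ℝ) + 1) by positivity)] with v hv
      simpa [Real.dist_eq] using hv
    filter_upwards [hb, self_mem_nhdsWithin] with v hv hvx
    have hne : v - x ≠ 0 := sub_ne_zero.2 hvx
    have hpos : 0 < |v - x| := abs_pos.2 hne
    have h3 := hxA u v hu hv
    have e1 : (v - x) • (γ u - γ x) - (u - x) • (γ v - γ x) =
        (v - x) • (γ u - γ x - (u - x) • slope γ x v) := by
      rw [slope_def_module, smul_sub (v - x) (γ u - γ x), smul_comm (v - x) (u - x), smul_inv_smul₀ hne]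
    rw [e1, norm_smul, Real.norm_eq_abs] at h3
    have h4 : |v - x| * ‖γ u - γ x - (u - x) • slope γ x v‖ ≤ |v - x| * (e * |u - x|) := by
      refine h3.trans ?_
      calc |u - x| * |v - x| / ((m : ℝ) + 1) = |v - x| * (1 / ((m : ℝ) + 1) * |u - x|) := by ring
        _ ≤ _ := by gcongr
    exact le_of_mul_le_mul_left h4 hpos

/-- Lusin approximation of absolutely continuous curves in ℝⁿ by C¹ curves. -/
theorem lusin_approx_euclidean {n : ℕ} (a b : ℝ) (hab : a < b)
    (γ g : ℝ → EuclideanSpace ℝ (Fin n))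
    (hint : IntegrableOn g (Icc a b))
    (hderiv : ∀ᵐ t ∂(volume.restrict (Icc a b)), HasDerivAt γ (g t) t)
    (hftc : ∀ t₁ ∈ Icc a b, ∀ t₂ ∈ Icc a b, γ t₂ = γ t₁ + ∫ t in t₁..t₂, g t)
    (ε : ℝ) (hε : 0 < ε) :
    ∃ Γ : ℝ → EuclideanSpace ℝ (Fin n), ContDiff ℝ 1 Γ ∧
      volume {t | t ∈ Icc a b ∧ (Γ t ≠ γ t ∨ deriv Γ t ≠ deriv γ t)} < ENNReal.ofReal ε := by
  -- a globally continuous modification of the curve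
  set γ' : ℝ → EuclideanSpace ℝ (Fin n) :=
    fun t => γ a + ∫ s in a..t, (Icc a b).indicator g s with hγ'
  have hγ'c : Continuous γ' := by
    have hi : Integrable ((Icc a b).indicator g) := hint.integrable_indicator measurableSet_Icc
    exact continuous_const.add
      (intervalIntegral.continuous_primitive (fun _ _ => hi.intervalIntegrable) a)
  have hγeq : ∀ t ∈ Icc a b, γ' t = γ t := by
    intro t ht
    rw [hftc a ⟨le_rfl, hab.le⟩ t ht]
    simp only [hγ']
    congr 1
    refine intervalIntegral.integral_congr fun s hs => ?_
    rw [uIcc_of_le ht.1] at hs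
    exact indicator_of_mem (show s ∈ Icc a b from ⟨hs.1, hs.2.trans ht.2⟩) g
  -- good points
  obtain ⟨N, hNsub, hNm, hN0⟩ := exists_measurable_superset_of_null
    ((ae_restrict_iff' measurableSet_Icc).1 hderiv)
  have hN : ∀ t ∈ Icc a b, t ∉ N → HasDerivAt γ (g t) t := by
    intro t ht htN
    by_contra hcon
    exact htN (hNsub (fun himp => hcon (himp ht)))
  have hε2 : ENNReal.ofReal (ε / 2) ≠ 0 := by
    rw [Ne, ENNReal.ofReal_eq_zero]; linarith
  obtain ⟨K₁, hK₁s, hK₁c, hK₁v⟩ := (measurableSet_Ioo.diff hNm).exists_isCompact_sdiff_lt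
    (μ := volume) (A := Ioo a b \ N)
    ((measure_mono sdiff_subset).trans_lt measure_Ioo_lt_top).ne hε2
  have hdγ : ∀ x ∈ K₁, HasDerivAt γ (g x) x := fun x hx =>
    hN x (Ioo_subset_Icc_self (hK₁s hx).1) (hK₁s hx).2
  have hdγ' : ∀ x ∈ K₁, HasDerivAt γ' (g x) x := fun x hx =>
    (hdγ x hx).congr_of_eventuallyEq (by
      filter_upwards [Icc_mem_nhds (hK₁s hx).1.1 (hK₁s hx).1.2] with t ht using hγeq t ht)
  obtain ⟨K, hKs, hKc, hKv, hKu⟩ := unif_diff γ' g hγ'c K₁ hK₁c hdγ' _ (pos_iff_ne_zero.2 hε2)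
  have hKI : ∀ x ∈ K, x ∈ Icc a b := fun x hx => Ioo_subset_Icc_self (hK₁s (hKs hx)).1
  -- the derivative is continuous on K
  have hgK : ContinuousOn g K := by
    rw [Metric.continuousOn_iff]
    intro x hx e he
    obtain ⟨δ, hδ, H⟩ := hKu (e / 4) (by positivity)
    refine ⟨δ, hδ, fun y hy hyx => ?_⟩
    rcases eq_or_ne y x with rfl | hne
    · simpa using he
    rw [Real.dist_eq] at hyx
    have h1 := H x hx y hyx
    have h2 := H y hy x (by rwa [abs_sub_comm])
    have hpos : 0 < |y - x| := abs_pos.2 (sub_ne_zero.2 hne)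
    rw [abs_sub_comm x y] at h2
    have e1 : (y - x) • (g y - g x) = (γ' y - γ' x - (y - x) • g x) +
      (γ' x - γ' y - (x - y) • g y) := by module
    have h3 := norm_add_le (γ' y - γ' x - (y - x) • g x) (γ' x - γ' y - (x - y) • g y)
    rw [← e1, norm_smul, Real.norm_eq_abs] at h3
    rw [dist_eq_norm]
    have h4 : |y - x| * ‖g y - g x‖ ≤ |y - x| * (e / 2) := by linarith
    have := le_of_mul_le_mul_left h4 hpos
    linarith
  obtain ⟨h₀, hh₀⟩ := ContinuousMap.exists_restrict_eq hKc.isClosed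
    (⟨K.domRestrict g, hgK.domRestrict⟩ : C(K, EuclideanSpace ℝ (Fin n)))
  have hh₀K : ∀ x ∈ K, h₀ x = g x := fun x hx => by
    have := congrArg (fun f => f ⟨x, hx⟩) hh₀
    exact this
  set H : ℝ → EuclideanSpace ℝ (Fin n) := fun t => ∫ s in a..t, h₀ s with hH
  have hHd : ∀ t, HasDerivAt H (h₀ t) t := fun t => h₀.continuous.integral_hasStrictDerivAt a t
    |>.hasDerivAt
  have hHdiff : ContDiff ℝ 1 H := by
    rw [contDiff_one_iff_deriv]
    refine ⟨fun t => (hHd t).differentiableAt, ?_⟩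
    rw [funext fun t => (hHd t).deriv]
    exact h₀.continuous
  have hHu : ∀ e > 0, ∃ δ > 0, ∀ x ∈ Icc a b, ∀ y ∈ Icc a b, |y - x| < δ →
      ‖H y - H x - (y - x) • h₀ x‖ ≤ e * |y - x| := by
    intro e he
    obtain ⟨δ, hδ, hu⟩ := Metric.uniformContinuousOn_iff.1
      (isCompact_Icc.uniformContinuousOn_of_continuous
        (h₀.continuous.continuousOn (s := Icc a b))) e he
    refine ⟨δ, hδ, fun x hx y hy hxy => ?_⟩
    have := (convex_uIcc x y).norm_image_sub_le_of_norm_hasDerivWithin_le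
      (f := fun t => H t - t • h₀ x) (f' := fun t => h₀ t - (1 : ℝ) • h₀ x) (C := e)
      (fun t _ => ((hHd t).sub ((hasDerivAt_id t).smul_const (h₀ x))).hasDerivWithinAt)
      (fun t ht => by
        have htI : t ∈ Icc a b := uIcc_subset_Icc hx hy ht
        have h1 : |t - x| ≤ |y - x| := by
          rw [abs_sub_comm y x]
          have := abs_sub_left_of_mem_uIcc ht
          rwa [abs_sub_comm y x] at this
        have := hu t htI x hx (by rw [Real.dist_eq]; exact h1.trans_lt hxy)
        rw [dist_eq_norm] at this
        simpa using this.le)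
      left_mem_uIcc right_mem_uIcc
    rw [Real.norm_eq_abs] at this
    have e1 : H y - H x - (y - x) • h₀ x = (H y - y • h₀ x) - (H x - x • h₀ x) := by module
    rw [e1]
    exact this
  obtain ⟨Γ, hΓ1, hΓ2⟩ := whitney_compact K hKc (fun t => γ' t - H t)
    (hγ'c.sub hHdiff.continuous) (by
      intro e he
      obtain ⟨δ₁, hδ₁, H1⟩ := hKu (e / 2) (by positivity)
      obtain ⟨δ₂, hδ₂, H2⟩ := hHu (e / 2) (by positivity)
      refine ⟨min δ₁ δ₂, by positivity, fun x hx y hy hxy => ?_⟩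
      have h1 := H1 x hx y (hxy.trans_le (min_le_left _ _))
      have h2 := H2 x (hKI x hx) y (hKI y hy) (hxy.trans_le (min_le_right _ _))
      rw [hh₀K x hx] at h2
      have e1 : γ' y - H y - (γ' x - H x) = (γ' y - γ' x - (y - x) • g x) -
        (H y - H x - (y - x) • g x) := by module
      rw [e1]
      refine (norm_sub_le _ _).trans ?_
      linarith)
  refine ⟨fun t => Γ t + H t, hΓ1.add hHdiff, ?_⟩
  have hsub : {t | t ∈ Icc a b ∧ (Γ t + H t ≠ γ t ∨ deriv (fun t => Γ t + H t) t ≠ deriv γ t)} ⊆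
      (({a, b} : Set ℝ) ∪ N) ∪ (((Ioo a b \ N) \ K₁) ∪ (K₁ \ K)) := by
    rintro t ⟨ht, hbad⟩
    have htK : t ∉ K := by
      intro htK
      obtain ⟨h1, h2⟩ := hΓ2 t htK
      rcases hbad with hb | hb
      · apply hb
        rw [h1, ← hγeq t ht]
        abel
      · apply hb
        have h3 := h2.add (hHd t)
        rw [(hdγ t (hKs htK)).deriv, ← hh₀K t htK, ← zero_add (h₀ t)]
        exact h3.deriv
    by_cases h1 : t ∈ K₁
    · exact Or.inr (Or.inr ⟨h1, htK⟩)
    by_cases h2 : t ∈ N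
    · exact Or.inl (Or.inr h2)
    rcases eq_or_lt_of_le ht.1 with h3 | h3
    · exact Or.inl (Or.inl (by simp [h3]))
    rcases eq_or_lt_of_le ht.2 with h4 | h4
    · exact Or.inl (Or.inl (by simp [h4]))
    exact Or.inr (Or.inl ⟨⟨⟨h3, h4⟩, h2⟩, h1⟩)
  have hz : volume (({a, b} : Set ℝ) ∪ N) = 0 :=
    measure_union_null ((Set.toFinite _).measure_zero _) hN0
  calc _ ≤ _ := measure_mono hsub
    _ ≤ _ := measure_union_le _ _
    _ ≤ 0 + (volume ((Ioo a b \ N) \ K₁) + volume (K₁ \ K)) := by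
        rw [hz]; gcongr; exact measure_union_le _ _
    _ < ENNReal.ofReal (ε / 2) + ENNReal.ofReal (ε / 2) := by
        rw [zero_add]; exact ENNReal.add_lt_add hK₁v hKv
    _ = ENNReal.ofReal ε := by
        rw [← ENNReal.ofReal_add (by linarith) (by linarith)]; congr 1; ring
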